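/- Let 1 < p < ∞. The space 𝓜_p fails the lower weak parallelogram property for every constant C > 0 and exponent r > 1: for every C > 0 and r > 1 there exist x, y ∈ 𝓜_p (namely x = 1 and y = z) with ‖x+y‖_{𝓜_p}^r + C‖x−y‖_{𝓜_p}^r > 2^{r−1}(‖x‖_{𝓜_p}^r + ‖y‖_{𝓜_p}^r). -/

import Mathlib

open ComplexConjugate
open scoped ENNReal

noncomputable section

/-- Cauchy product of coefficient sequences (multiplication of power series). -/
def cauchyMul (f g : ℕ → ℂ) : ℕ → ℂ :=
  fun n => ∑ k ∈ Finset.range (n + 1), f k * g (n - k)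

/-- Membership in `ℓᵖ_A`: the coefficient sequence is `p`-summable (`p` finite). -/
def MemLpA (p : ℝ) (f : ℕ → ℂ) : Prop :=
  Summable fun k => ‖f k‖ ^ p

/-- The `ℓᵖ` norm of a coefficient sequence (`p` finite). -/
def pNorm (p : ℝ) (f : ℕ → ℂ) : ℝ :=
  (∑' k, ‖f k‖ ^ p) ^ (1 / p)

/-- `φ` is a multiplier of `ℓᵖ_A`. -/
def IsMultiplier (p : ℝ) (φ : ℕ → ℂ) : Prop :=
  ∀ f : ℕ → ℂ, MemLpA p f → MemLpA p (cauchyMul φ f)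

/-- The multiplier norm of `φ`, i.e. the operator norm of multiplication by `φ` on `ℓᵖ_A`. -/
def multNorm (p : ℝ) (φ : ℕ → ℂ) : ℝ :=
  sSup { x : ℝ | ∃ f : ℕ → ℂ, MemLpA p f ∧ pNorm p f ≤ 1 ∧ x = pNorm p (cauchyMul φ f) }

/-- Multiplication by `a + c z` on coefficient sequences. -/
theorem cauchyMul_linear (a c : ℂ) (f : ℕ → ℂ) (n : ℕ) :
    cauchyMul (fun n => (if n = 0 then a else 0) + (if n = 1 then c else 0)) f n
      = a * f n + c * (if n = 0 then 0 else f (n - 1)) := by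
  unfold cauchyMul
  cases n with
  | zero => simp
  | succ m =>
    rw [Finset.sum_range_succ', Finset.sum_range_succ']
    simp [add_comm]

theorem memLpA_cauchyMul_linear {p : ℝ} (hp : 1 < p) {a c : ℂ} (ha : ‖a‖ ≤ 1) (hc : ‖c‖ ≤ 1)
    {f : ℕ → ℂ} (hf : MemLpA p f) :
    MemLpA p (cauchyMul (fun n => (if n = 0 then a else 0) + (if n = 1 then c else 0)) f) ∧
      ∑' k, ‖cauchyMul (fun n => (if n = 0 then a else 0) + (if n = 1 then c else 0)) f k‖ ^ p
        ≤ 2 ^ p * (2 * ∑' k, ‖f k‖ ^ p) := by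
  have hp0 : p ≠ 0 := by positivity
  set g : ℕ → ℝ := fun k => ‖(if k = 0 then 0 else f (k - 1) : ℂ)‖ ^ p with hg
  have hf' : Summable fun k => ‖f k‖ ^ p := hf
  have hgs : Summable g := by
    rw [← summable_nat_add_iff 1]
    simpa [hg] using hf'
  have hgt : ∑' k, g k = ∑' k, ‖f k‖ ^ p := by
    rw [hgs.tsum_eq_zero_add]
    simp [hg, Real.zero_rpow hp0]
  have hle : ∀ k,
      ‖cauchyMul (fun n => (if n = 0 then a else 0) + (if n = 1 then c else 0)) f k‖ ^ p
        ≤ 2 ^ p * (‖f k‖ ^ p + g k) := by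
    intro k
    rw [cauchyMul_linear]
    set u := f k
    set v : ℂ := if k = 0 then 0 else f (k - 1) with hv
    have hgv : g k = ‖v‖ ^ p := rfl
    have h1 : ‖a * u + c * v‖ ≤ 2 * max ‖u‖ ‖v‖ := by
      calc ‖a * u + c * v‖ ≤ ‖a‖ * ‖u‖ + ‖c‖ * ‖v‖ := by
            simpa using norm_add_le (a * u) (c * v)
        _ ≤ 1 * max ‖u‖ ‖v‖ + 1 * max ‖u‖ ‖v‖ := by
            gcongr
            · exact le_max_left _ _
            · exact le_max_right _ _
        _ = 2 * max ‖u‖ ‖v‖ := by ring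
    rw [hgv]
    calc ‖a * u + c * v‖ ^ p ≤ (2 * max ‖u‖ ‖v‖) ^ p := by gcongr
      _ = 2 ^ p * (max ‖u‖ ‖v‖) ^ p :=
          Real.mul_rpow (by norm_num) (le_max_of_le_left (norm_nonneg _))
      _ ≤ 2 ^ p * (‖u‖ ^ p + ‖v‖ ^ p) := by
          gcongr
          have hu : 0 ≤ ‖u‖ ^ p := by positivity
          have hv : 0 ≤ ‖v‖ ^ p := by positivity
          rcases max_cases ‖u‖ ‖v‖ with h | h <;> rw [h.1] <;> linarith
  have hs : Summable fun k => 2 ^ p * (‖f k‖ ^ p + g k) := (hf'.add hgs).mul_left _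
  have hm := Summable.of_nonneg_of_le (fun k => by positivity) hle hs
  refine ⟨hm, (hm.tsum_le_tsum hle hs).trans_eq ?_⟩
  rw [tsum_mul_left, hf'.tsum_add hgs, hgt]
  ring

theorem tsum_le_one_of_pNorm_le_one {p : ℝ} (hp : 1 < p) {f : ℕ → ℂ} (h : pNorm p f ≤ 1) :
    ∑' k, ‖f k‖ ^ p ≤ 1 := by
  by_contra! h'
  exact absurd (Real.one_lt_rpow h' (by positivity : 0 < 1 / p)) (not_lt.mpr h)

theorem bddAbove_pNorm_cauchyMul_linear {p : ℝ} (hp : 1 < p) {a c : ℂ} (ha : ‖a‖ ≤ 1)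
    (hc : ‖c‖ ≤ 1) :
    BddAbove { x : ℝ | ∃ f : ℕ → ℂ, MemLpA p f ∧ pNorm p f ≤ 1 ∧ x = pNorm p
      (cauchyMul (fun n => (if n = 0 then a else 0) + (if n = 1 then c else 0)) f) } := by
  refine ⟨(2 ^ p * (2 * 1)) ^ (1 / p), ?_⟩
  rintro x ⟨f, hf, hf1, rfl⟩
  have hS := tsum_le_one_of_pNorm_le_one hp hf1
  refine Real.rpow_le_rpow (tsum_nonneg fun k => by positivity)
    ((memLpA_cauchyMul_linear hp ha hc hf).2.trans ?_) (by positivity)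
  gcongr

/-- Normalized truncations of the geometric series `∑ cᵏ zᵏ` show that `1 + c z` has multiplier
norm at least `2`. -/
theorem two_le_multNorm_linear {p : ℝ} (hp : 1 < p) {c : ℂ} (hc : ‖c‖ = 1) :
    2 ≤ multNorm p (fun n => (if n = 0 then 1 else 0) + (if n = 1 then c else 0)) := by
  have hp0 : p ≠ 0 := by positivity
  have hlim : Filter.Tendsto (fun N : ℕ => (2 ^ p * ((N : ℝ) / (N + 1))) ^ (1 / p)) Filter.atTop
      (nhds 2) := by
    have h1 := (tendsto_natCast_div_add_atTop (1 : ℝ)).const_mul ((2 : ℝ) ^ p)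
    have h2 := h1.rpow_const (p := 1 / p) (Or.inr (by positivity))
    rwa [mul_one, one_div, Real.rpow_rpow_inv (by norm_num) hp0, ← one_div] at h2
  refine le_of_tendsto' hlim fun N => ?_
  set t : ℝ := ((N : ℝ) + 1)⁻¹ ^ p⁻¹ with ht
  have ht0 : 0 ≤ t := by positivity
  have htp : t ^ p = ((N : ℝ) + 1)⁻¹ := Real.rpow_inv_rpow (by positivity) hp0
  set f : ℕ → ℂ := fun k => if k < N + 1 then (t : ℂ) * c ^ k else 0 with hf
  have hfk : ∀ k ∈ Finset.range (N + 1), ‖f k‖ ^ p = ((N : ℝ) + 1)⁻¹ := by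
    intro k hk
    simp only [hf, if_pos (Finset.mem_range.mp hk)]
    rw [norm_mul, norm_pow, hc, one_pow, mul_one, Complex.norm_real, Real.norm_of_nonneg ht0, htp]
  have hf0 : ∀ k ∉ Finset.range (N + 1), ‖f k‖ ^ p = 0 := by
    intro k hk
    simp only [hf, if_neg (fun h => hk (Finset.mem_range.mpr h)), norm_zero, Real.zero_rpow hp0]
  have hmem : MemLpA p f := summable_of_ne_finset_zero hf0
  have hnorm : pNorm p f ≤ 1 := by
    unfold pNorm
    rw [tsum_eq_sum hf0, Finset.sum_congr rfl hfk]
    have : ((N : ℝ) + 1) ≠ 0 := by positivity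
    simp [this]
  refine le_trans ?_ (le_csSup (bddAbove_pNorm_cauchyMul_linear hp (by simp) hc.le)
    ⟨f, hmem, hnorm, rfl⟩)
  refine Real.rpow_le_rpow (by positivity) ?_ (by positivity)
  have hs := (memLpA_cauchyMul_linear hp (a := 1) (by simp) hc.le hmem).1
  have hs' : Summable fun k =>
    ‖cauchyMul (fun n => (if n = 0 then 1 else 0) + (if n = 1 then c else 0)) f k‖ ^ p := hs
  rw [hs'.tsum_eq_zero_add]
  have hterm : ∀ k ∈ Finset.range N,
      ‖cauchyMul (fun n => (if n = 0 then 1 else 0) + (if n = 1 then c else 0)) f (k + 1)‖ ^ p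
        = 2 ^ p * ((N : ℝ) + 1)⁻¹ := by
    intro k hk
    have hk' := Finset.mem_range.mp hk
    rw [cauchyMul_linear]
    have h1 : 1 * f (k + 1) + c * (if k + 1 = 0 then 0 else f (k + 1 - 1))
        = 2 * ((t : ℂ) * c ^ (k + 1)) := by
      simp only [hf, Nat.add_sub_cancel, if_neg (Nat.succ_ne_zero k),
        if_pos (show k + 1 < N + 1 by omega), if_pos (show k < N + 1 by omega)]
      ring
    rw [h1, norm_mul, norm_mul, norm_pow, hc, one_pow, mul_one, Complex.norm_real,
      Real.norm_of_nonneg ht0, Complex.norm_ofNat, Real.mul_rpow (by norm_num) ht0, htp]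
  have hsum := ((summable_nat_add_iff 1).mpr hs').sum_le_tsum (Finset.range N)
    (fun k _ => by positivity)
  rw [Finset.sum_congr rfl hterm, Finset.sum_const, Finset.card_range, nsmul_eq_mul] at hsum
  have h0 : 0 ≤
    ‖cauchyMul (fun n => (if n = 0 then 1 else 0) + (if n = 1 then c else 0)) f 0‖ ^ p := by
    positivity
  calc 2 ^ p * ((N : ℝ) / (N + 1)) = N * (2 ^ p * ((N : ℝ) + 1)⁻¹) := by ring
    _ ≤ _ := hsum
    _ ≤ _ := le_add_of_nonneg_left h0

theorem multNorm_nonneg (p : ℝ) (φ : ℕ → ℂ) : 0 ≤ multNorm p φ := by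
  refine Real.sSup_nonneg ?_
  rintro x ⟨f, -, -, rfl⟩
  exact Real.rpow_nonneg (tsum_nonneg fun k => by positivity) _

theorem multNorm_le_one {p : ℝ} {φ : ℕ → ℂ}
    (h : ∀ f, MemLpA p f → ∑' k, ‖cauchyMul φ f k‖ ^ p = ∑' k, ‖f k‖ ^ p) :
    multNorm p φ ≤ 1 := by
  refine Real.sSup_le ?_ zero_le_one
  rintro x ⟨f, hf, hf1, rfl⟩
  unfold pNorm
  rw [h f hf]
  exact hf1

/-- `𝓜_p` fails the lower weak parallelogram property for every `C > 0` and `r > 1`;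
witnesses are `x = 1` and `y = z`. -/
theorem multiplier_space_fails_LWP (p : ℝ) (hp : 1 < p) (C r : ℝ) (hC : 0 < C) (hr : 1 < r) :
    ∃ x y : ℕ → ℂ, IsMultiplier p x ∧ IsMultiplier p y ∧
      x = (fun n => if n = 0 then (1 : ℂ) else 0) ∧
      y = (fun n => if n = 1 then (1 : ℂ) else 0) ∧
      multNorm p (fun n => x n + y n) ^ r + C * multNorm p (fun n => x n - y n) ^ r
        > 2 ^ (r - 1) * (multNorm p x ^ r + multNorm p y ^ r) := by
  have hp0 : p ≠ 0 := by positivity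
  have hx : (fun n : ℕ => if n = 0 then (1 : ℂ) else 0)
      = fun n => (if n = 0 then 1 else 0) + (if n = 1 then 0 else 0) := by simp
  have hy : (fun n : ℕ => if n = 1 then (1 : ℂ) else 0)
      = fun n => (if n = 0 then 0 else 0) + (if n = 1 then 1 else 0) := by simp
  have hxm : IsMultiplier p (fun n : ℕ => if n = 0 then (1 : ℂ) else 0) := by
    intro f hf
    rw [hx]
    exact (memLpA_cauchyMul_linear hp (by simp) (by simp) hf).1
  have hym : IsMultiplier p (fun n : ℕ => if n = 1 then (1 : ℂ) else 0) := by
    intro f hf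
    rw [hy]
    exact (memLpA_cauchyMul_linear hp (by simp) (by simp) hf).1
  refine ⟨_, _, hxm, hym, rfl, rfl, ?_⟩
  have hx1 : multNorm p (fun n : ℕ => if n = 0 then (1 : ℂ) else 0) ≤ 1 := by
    refine multNorm_le_one fun f hf => ?_
    simp only [hx, cauchyMul_linear, one_mul, zero_mul, add_zero]
  have hy1 : multNorm p (fun n : ℕ => if n = 1 then (1 : ℂ) else 0) ≤ 1 := by
    refine multNorm_le_one fun f hf => ?_
    have hs : Summable fun k =>
        ‖cauchyMul (fun n : ℕ => if n = 1 then (1 : ℂ) else 0) f k‖ ^ p := hym f hf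
    rw [hs.tsum_eq_zero_add]
    simp only [hy, cauchyMul_linear]
    simp [Real.zero_rpow hp0]
  have hadd := two_le_multNorm_linear hp (c := 1) (by simp)
  have hsub : 2 ≤ multNorm p
      (fun n : ℕ => (if n = 0 then (1 : ℂ) else 0) - (if n = 1 then (1 : ℂ) else 0)) := by
    have h := two_le_multNorm_linear hp (c := -1) (by simp)
    convert h using 3 with n
    split_ifs <;> simp
  have hr0 : 0 ≤ r := by linarith
  have hxr := Real.rpow_le_one (multNorm_nonneg p _) hx1 hr0
  have hyr := Real.rpow_le_one (multNorm_nonneg p _) hy1 hr0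
  have haddr := Real.rpow_le_rpow (by norm_num) hadd hr0
  have hsubr : 0 < C * multNorm p (fun n : ℕ =>
      (if n = 0 then (1 : ℂ) else 0) - (if n = 1 then (1 : ℂ) else 0)) ^ r :=
    mul_pos hC (Real.rpow_pos_of_pos (by linarith) r)
  have h2 : (2 : ℝ) ^ (r - 1) * 2 = 2 ^ r := by
    rw [Real.rpow_sub_one (by norm_num)]
    ring
  have h3 := mul_le_mul_of_nonneg_left (add_le_add hxr hyr)
    (by positivity : (0 : ℝ) ≤ 2 ^ (r - 1))
  have h4 : (1 : ℝ) + 1 = 2 := by norm_num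
  rw [h4, h2] at h3
  exact lt_of_le_of_lt (h3.trans haddr) (lt_add_of_pos_right _ hsubr)
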